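/- Let u ∈ F^N be a vector with pairwise distinct coordinates over a field F, let V(u) = (u_i^{j-1}) be the Vandermonde matrix, and let M ≥ N. Then the solution s of V(u) s = u^{∘M} is given by s_i = (-1)^{N-i} s_{μ(M,N,i-1)}(u) for 1 ≤ i ≤ N, where u^{∘M} is the vector of M-th powers of coordinates of u. -/

import Mathlib

open Matrix BigOperators

/-- Complete homogeneous symmetric polynomial `h_k`, as a function of a point `x ∈ F^N`. -/
def hfun {F : Type*} [CommRing F] {N : ℕ} (x : Fin N → F) (k : ℕ) : F :=
  ∑ d ∈ Finset.univ.filter (fun d : Fin N → Fin (k + 1) => ∑ i, (d i : ℕ) = k),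
    ∏ i, x i ^ (d i : ℕ)

/-- Schur polynomial (via the Jacobi–Trudi identity) of the partition `lam`,
evaluated at the point `x ∈ F^N`. -/
def schurAt {F : Type*} [CommRing F] {N : ℕ} (x : Fin N → F) (lam : Fin N → ℕ) : F :=
  Matrix.det (Matrix.of fun i j : Fin N =>
    if (i : ℕ) ≤ lam i + (j : ℕ) then hfun x (lam i + (j : ℕ) - (i : ℕ)) else 0)

/-- The hook partition `μ(M,N,j) = (M-N+1, 1^{N-j-1}, 0^j)`. -/
def hookP (M N j : ℕ) : Fin N → ℕ :=
  fun i => if (i : ℕ) = 0 then M - N + 1 else if (i : ℕ) < N - j then 1 else 0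

/-- Vandermonde determinant `Δ_N(x) = ∏_{i<j} (x_i - x_j)`. -/
def vdm {F : Type*} [CommRing F] {N : ℕ} (x : Fin N → F) : F :=
  ∏ i : Fin N, ∏ j ∈ Finset.Ioi i, (x i - x j)

lemma hfun_eq_coeff {F : Type*} [Field F] {N : ℕ} (x : Fin N → F) (k : ℕ) :
    hfun x k = PowerSeries.coeff k (∏ i, PowerSeries.mk (fun n => x i ^ n)) := by
  classical
  rw [PowerSeries.coeff_prod, hfun]
  have key : ∀ l ∈ Finset.finsuppAntidiag (Finset.univ : Finset (Fin N)) k, ∀ i, l i < k + 1 := by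
    intro l hl i
    rw [Finset.mem_finsuppAntidiag] at hl
    have := Finset.single_le_sum (f := fun i => l i) (fun _ _ => Nat.zero_le _) (Finset.mem_univ i)
    have h1 : ∑ x, l x = k := hl.1
    omega
  refine Finset.sum_bij' (fun d _ => Finsupp.equivFunOnFinite.symm (fun i => (d i : ℕ)))
    (fun l hl i => ⟨l i, key l hl i⟩) ?_ ?_ ?_ ?_ ?_
  · intro d hd
    simpa using hd
  · intro l hl
    simpa using hl
  · intro d hd
    ext i
    simp
  · intro l hl
    ext i
    simp
  · intro d hd
    simp

lemma geom_mul {F : Type*} [Field F] (a : F) :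
    (1 - PowerSeries.C a * PowerSeries.X) * PowerSeries.mk (fun n => a ^ n) = 1 := by
  ext n
  cases n with
  | zero => simp
  | succ n =>
    rw [sub_mul, one_mul, map_sub, mul_assoc, PowerSeries.coeff_C_mul,
      PowerSeries.coeff_succ_X_mul]
    simp [pow_succ, PowerSeries.coeff_one, mul_comm]

lemma exists_w {F : Type*} [Field F] (N : ℕ) (hN : 1 ≤ N) (u : Fin N → F)
    (hu : Function.Injective u) : ∃ w : Fin N → F, ∀ m : ℕ,
      ∑ i, w i * u i ^ m = if N - 1 ≤ m then hfun u (m - (N - 1)) else 0 := by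
  classical
  have hdet : IsUnit ((vandermonde u)ᵀ) := by
    rw [isUnit_iff_isUnit_det, det_transpose]
    exact (det_vandermonde_ne_zero_iff.2 hu).isUnit
  obtain ⟨w, hw⟩ := mulVec_surjective_iff_isUnit.2 hdet
    (fun m : Fin N => if (m : ℕ) = N - 1 then 1 else 0)
  have hw' : ∀ m : ℕ, m < N → ∑ i, w i * u i ^ m = if m = N - 1 then 1 else 0 := by
    intro m hm
    have := congrFun hw ⟨m, hm⟩
    simpa [mulVec, dotProduct, vandermonde, mul_comm] using this
  refine ⟨w, ?_⟩
  let G : Fin N → PowerSeries F := fun i => PowerSeries.mk (fun n => u i ^ n)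
  let D : Fin N → PowerSeries F := fun i => 1 - PowerSeries.C (u i) * PowerSeries.X
  let W : PowerSeries F := ∑ i, PowerSeries.C (w i) * G i
  have hDG : ∀ i, D i * G i = 1 := fun i => geom_mul (u i)
  have hEH : (∏ i, D i) * (∏ i, G i) = 1 := by
    rw [← Finset.prod_mul_distrib]
    exact Finset.prod_eq_one fun i _ => hDG i
  have hWc : ∀ m, PowerSeries.coeff m W = ∑ i, w i * u i ^ m := by
    intro m
    simp [W, G]
  have hEW1 : (∏ i, D i) * W = ∑ i, PowerSeries.C (w i) * ∏ j ∈ Finset.univ.erase i, D j := by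
    rw [Finset.mul_sum]
    refine Finset.sum_congr rfl fun i _ => ?_
    rw [← Finset.mul_prod_erase Finset.univ D (Finset.mem_univ i)]
    linear_combination (PowerSeries.C (w i) * ∏ j ∈ Finset.univ.erase i, D j) * hDG i
  have hdeg : ∀ i n, N ≤ n → PowerSeries.coeff n (∏ j ∈ Finset.univ.erase i, D j) = 0 := by
    intro i n hn
    have h1 : (∏ j ∈ Finset.univ.erase i, D j) =
        ((∏ j ∈ Finset.univ.erase i, (1 - Polynomial.C (u j) * Polynomial.X) :
          Polynomial F) : PowerSeries F) := by
      rw [← Polynomial.coeToPowerSeries.ringHom_apply, map_prod]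
      refine Finset.prod_congr rfl fun j _ => ?_
      simp [D]
    rw [h1, Polynomial.coeff_coe]
    apply Polynomial.coeff_eq_zero_of_natDegree_lt
    refine lt_of_le_of_lt (Polynomial.natDegree_prod_le _ _) ?_
    refine lt_of_le_of_lt (Finset.sum_le_card_nsmul _ _ 1 ?_) ?_
    · intro j _
      compute_degree
    · simp
      omega
  have hE0 : PowerSeries.coeff 0 (∏ i, D i) = 1 := by
    simp [D, map_prod]
  have hEW : (∏ i, D i) * W = PowerSeries.X ^ (N - 1) := by
    ext n
    rw [PowerSeries.coeff_X_pow]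
    by_cases hn : n < N
    · rw [PowerSeries.coeff_mul]
      have : ∀ p ∈ Finset.HasAntidiagonal.antidiagonal n, PowerSeries.coeff p.1 (∏ i, D i) *
          PowerSeries.coeff p.2 W = if p = (0, N - 1) then 1 else 0 := by
        rintro ⟨a, b⟩ hp
        rw [Finset.HasAntidiagonal.mem_antidiagonal] at hp
        simp only at hp
        simp only [Prod.mk.injEq]
        rw [hWc, hw' b (by omega)]
        by_cases hb : b = N - 1
        · have ha : a = 0 := by omega
          rw [ha, hE0]; simp [hb]
        · simp [hb]
      rw [Finset.sum_congr rfl this, Finset.sum_ite_eq']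
      simp [Finset.HasAntidiagonal.mem_antidiagonal, eq_comm]
    · rw [hEW1, map_sum, if_neg (by omega)]
      refine Finset.sum_eq_zero fun i _ => ?_
      rw [PowerSeries.coeff_C_mul, hdeg i n (by omega), mul_zero]
  have hW : W = PowerSeries.X ^ (N - 1) * ∏ i, G i := by
    rw [← hEW]
    linear_combination (-W) * hEH
  intro m
  rw [← hWc, hW, PowerSeries.coeff_X_pow_mul']
  split_ifs
  · rw [hfun_eq_coeff]
  · rfl

lemma hfun_zero {F : Type*} [Field F] {N : ℕ} (x : Fin N → F) : hfun x 0 = 1 := by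
  rw [hfun_eq_coeff]
  simp [map_prod]

/-- The solution of the Vandermonde linear system `V(u) s = u^{∘M}` is given by signed
Schur polynomials of hook shapes evaluated at `u`. -/
theorem vandermonde_solution_schur {F : Type*} [Field F] (N M : ℕ) (hN : 1 ≤ N) (hMN : N ≤ M)
    (u : Fin N → F) (hu : Function.Injective u) (s : Fin N → F)
    (hs : (Matrix.of fun i j : Fin N => u i ^ (j : ℕ)).mulVec s = fun i => u i ^ M) :
    ∀ i : Fin N, s i = (-1 : F) ^ (N - (i : ℕ) - 1) * schurAt u (hookP M N (i : ℕ)) := by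
  classical
  intro i
  obtain ⟨w, hw⟩ := exists_w N hN u hu
  have hs' : ∀ a, ∑ k : Fin N, u a ^ (k : ℕ) * s k = u a ^ M := by
    intro a
    simpa [mulVec, dotProduct] using congrFun hs a
  let T : Matrix (Fin N) (Fin N) F := Matrix.of fun r c =>
    if (r : ℕ) ≤ (c : ℕ) then hfun u ((c : ℕ) - r) else 0
  let v : Fin N → F := fun c => hfun u (M - N + 1 + c)
  have hT : T.det = 1 := by
    rw [det_of_upperTriangular]
    · exact Finset.prod_eq_one fun r _ => by simp [T, hfun_zero]
    · intro r c h
      simp only [id] at h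
      have : (c : ℕ) < r := h
      simp only [T, Matrix.of_apply]
      rw [if_neg (by omega)]
  have hv : v = ∑ k, (s (Fin.rev k)) • T k := by
    ext c
    rw [← Equiv.sum_comp Fin.revPerm]
    have e1 : v c = ∑ a, w a * u a ^ (M + c) := by
      rw [hw, if_pos (by omega)]
      simp only [v]
      congr 1
      omega
    have e2 : ∀ k : Fin N, T (Fin.rev k) c = ∑ a, w a * u a ^ (k + c : ℕ) := by
      intro k
      rw [hw]
      simp only [T, Matrix.of_apply, Fin.val_rev]
      have := k.2
      by_cases h : N - 1 ≤ (k : ℕ) + c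
      · rw [if_pos h, if_pos (by omega)]
        congr 1
        omega
      · rw [if_neg h, if_neg (by omega)]
    simp only [Finset.sum_apply, Pi.smul_apply, Fin.revPerm_apply, Fin.rev_rev, smul_eq_mul, e2]
    rw [e1]
    simp_rw [Finset.mul_sum]
    rw [Finset.sum_comm]
    refine Finset.sum_congr rfl fun a _ => ?_
    rw [pow_add, ← hs' a, Finset.sum_mul, Finset.mul_sum]
    refine Finset.sum_congr rfl fun k _ => ?_
    rw [pow_add]; ring
  have hU : (T.updateRow (Fin.rev i) v).det = s i := by
    rw [hv, det_updateRow_sum, hT]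
    simp
  have hi := i.2
  have hA : (Matrix.of fun r c : Fin N =>
      if (r : ℕ) ≤ hookP M N i r + (c : ℕ) then hfun u (hookP M N i r + (c : ℕ) - (r : ℕ))
      else 0).submatrix (Fin.cycleRange (Fin.rev i)) id = T.updateRow (Fin.rev i) v := by
    ext r c
    simp only [submatrix_apply, id, Matrix.of_apply]
    have hk : ((Fin.rev i : Fin N) : ℕ) = N - (i + 1) := Fin.val_rev i
    rcases lt_trichotomy r (Fin.rev i) with h | h | h
    · have h' : (r : ℕ) < N - (i + 1) := by rw [← hk]; exact h
      rw [updateRow_ne h.ne]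
      have hc := Fin.coe_cycleRange_of_lt h
      have hh : hookP M N i ((Fin.rev i).cycleRange r) = 1 := by
        unfold hookP
        rw [if_neg (by omega), if_pos (by omega)]
      simp only [hh, hc, T, Matrix.of_apply]
      by_cases hrc : (r : ℕ) ≤ c
      · rw [if_pos (by omega), if_pos hrc]; congr 1; omega
      · rw [if_neg (by omega), if_neg hrc]
    · subst h
      rw [updateRow_self]
      have hc := Fin.coe_cycleRange_of_le (le_refl (Fin.rev i))
      rw [if_pos rfl] at hc
      simp [hookP, hc, v]
    · have h' : N - (i + 1) < (r : ℕ) := by rw [← hk]; exact h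
      rw [updateRow_ne h.ne', Fin.cycleRange_of_gt h]
      have hh : hookP M N i r = 0 := by
        unfold hookP
        rw [if_neg (by omega), if_neg (by omega)]
      simp only [hh, T, Matrix.of_apply, zero_add]
  have hdet := det_permute (Fin.cycleRange (Fin.rev i)) (Matrix.of fun r c : Fin N =>
      if (r : ℕ) ≤ hookP M N i r + (c : ℕ) then hfun u (hookP M N i r + (c : ℕ) - (r : ℕ))
      else 0)
  rw [hA, hU, Fin.sign_cycleRange] at hdet
  rw [hdet, schurAt, Fin.val_rev, Nat.sub_sub]
  simp
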